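/- arXiv:1712.09946 — 10 statements merged into one kernel-verified Lean document; each statement's English description precedes it below -/
import Mathlib

section
/- Let J ∈ 𝕊 and let P : ℍ∖ℝ → ℍ be defined by P(α+βI) = ((1−I·J)/2)·Σ_{n=0}^{N} (α+βJ)ⁿ·aₙ + ((1+I·J)/2)·Σ_{m=0}^{M} (α−βJ)ᵐ·bₘ (for all α ∈ ℝ, β > 0, I ∈ 𝕊), where a₀,…,a_N, b₀,…,b_M are quaternions. Then for every K ∈ 𝕊 there exist quaternions a'₀,…,a'_N', b'₀,…,b'_M' such that P(α+βI) = ((1−I·K)/2)·Σ_{n} (α+βK)ⁿ·a'ₙ + ((1+I·K)/2)·Σ_{m} (α−βK)ᵐ·b'ₘ for all α ∈ ℝ, β > 0, I ∈ 𝕊. In particular, the restriction of P to the half-slice {α+βK : α ∈ ℝ, β > 0} is given by a polynomial with right quaternionic coefficients in the variable α+βK. -/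
open Finset Quaternion

namespace Quaternion

theorem div_two_eq_smul (x : Quaternion ℝ) : x / 2 = (2⁻¹ : ℝ) • x := by
  rw [div_eq_mul_inv, Algebra.smul_def, Algebra.commutes, map_inv₀, map_ofNat]

/-- The factor `(1 - I * J) / 2` intertwines `α + β J` and `α + β I`. -/
theorem semiconjBy_one_sub_mul_div_two {I J : Quaternion ℝ} (hI : I * I = -1) (hJ : J * J = -1)
    (α β : ℝ) :
    SemiconjBy ((1 - I * J) / 2) ((α : Quaternion ℝ) + β • J) ((α : Quaternion ℝ) + β • I) := by
  have hIJJ : I * J * J = -I := by rw [mul_assoc, hJ, mul_neg_one]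
  have hIIJ : I * (I * J) = -J := by rw [← mul_assoc, hI, neg_one_mul]
  rw [SemiconjBy, div_two_eq_smul, smul_mul_assoc, mul_smul_comm]
  congr 1
  rw [mul_add, ← coe_commutes, add_mul, mul_smul_comm, smul_mul_assoc, sub_mul, mul_sub I, hIJJ,
    hIIJ, one_mul, mul_one, sub_neg_eq_add, sub_neg_eq_add, add_comm J I]

theorem semiconjBy_one_add_mul_div_two {I J : Quaternion ℝ} (hI : I * I = -1) (hJ : J * J = -1)
    (α β : ℝ) :
    SemiconjBy ((1 + I * J) / 2) ((α : Quaternion ℝ) - β • J) ((α : Quaternion ℝ) + β • I) := by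
  have hJ' : -J * -J = -1 := by rw [neg_mul_neg, hJ]
  simpa only [mul_neg, sub_neg_eq_add, smul_neg, ← sub_eq_add_neg] using
    semiconjBy_one_sub_mul_div_two hI hJ' α β

/-- A slice polynomial with respect to `J`, written through powers of the variable `α + β I`. -/
theorem slicePolynomial_eq_sum_pow_mul {I J : Quaternion ℝ} (hI : I * I = -1) (hJ : J * J = -1)
    (α β : ℝ) (s t : Finset ℕ) (a b : ℕ → Quaternion ℝ) :
    ((1 - I * J) / 2) * (∑ n ∈ s, ((α : Quaternion ℝ) + β • J) ^ n * a n) +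
        ((1 + I * J) / 2) * (∑ m ∈ t, ((α : Quaternion ℝ) - β • J) ^ m * b m) =
      ∑ n ∈ s, ((α : Quaternion ℝ) + β • I) ^ n * (((1 - I * J) / 2) * a n) +
        ∑ m ∈ t, ((α : Quaternion ℝ) + β • I) ^ m * (((1 + I * J) / 2) * b m) := by
  simp only [mul_sum, ← mul_assoc, ((semiconjBy_one_sub_mul_div_two hI hJ α β).pow_right _).eq,
    ((semiconjBy_one_add_mul_div_two hI hJ α β).pow_right _).eq]

theorem slice_coefficient_change_of_unit {K : Quaternion ℝ} (hK : K * K = -1)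
    (I J a b : Quaternion ℝ) :
    ((1 - I * J) / 2) * a + ((1 + I * J) / 2) * b =
      ((1 - I * K) / 2) * ((2⁻¹ : ℝ) • (a + b + K * J * (b - a))) +
        ((1 + I * K) / 2) * ((2⁻¹ : ℝ) • (a + b - K * J * (b - a))) := by
  have hIKK (x : Quaternion ℝ) : I * (K * (K * x)) = -(I * x) := by
    rw [← mul_assoc K, hK, neg_one_mul, mul_neg]
  simp only [div_two_eq_smul, smul_mul_assoc, mul_smul_comm, mul_add, mul_sub, add_mul, sub_mul,
    one_mul, mul_assoc, hIKK]
  module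

theorem sum_range_mul_eq_sum_range_mul_ite {R : Type*} [NonUnitalNonAssocSemiring R] {N L : ℕ}
    (h : N ≤ L) (f a : ℕ → R) :
    ∑ n ∈ range N, f n * a n = ∑ n ∈ range L, f n * (if n < N then a n else 0) := by
  rw [← sum_subset (range_subset_range.2 h)]
  · exact sum_congr rfl fun n hn => by rw [if_pos (mem_range.1 hn)]
  · intro n _ hn
    rw [if_neg (by simpa using hn), mul_zero]

end Quaternion

/-- Given a slice-polynomial function written with respect to the imaginary unit `J`,
it can be rewritten with respect to any other imaginary unit `K`. -/
theorem slicePolynomial_change_of_unit (N M : ℕ) (a b : ℕ → Quaternion ℝ)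
    (J : Quaternion ℝ) (hJ : J * J = -1)
    (P : Quaternion ℝ → Quaternion ℝ)
    (hP : ∀ (α β : ℝ) (I : Quaternion ℝ), 0 < β → I * I = -1 →
      P ((α : Quaternion ℝ) + β • I) =
        ((1 - I * J) / 2) *
          (∑ n ∈ Finset.range (N + 1), ((α : Quaternion ℝ) + β • J) ^ n * a n) +
        ((1 + I * J) / 2) *
          (∑ m ∈ Finset.range (M + 1), ((α : Quaternion ℝ) - β • J) ^ m * b m)) :
    ∀ K : Quaternion ℝ, K * K = -1 →
      ∃ (N' M' : ℕ) (a' b' : ℕ → Quaternion ℝ),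
        ∀ (α β : ℝ) (I : Quaternion ℝ), 0 < β → I * I = -1 →
          P ((α : Quaternion ℝ) + β • I) =
            ((1 - I * K) / 2) *
              (∑ n ∈ Finset.range (N' + 1), ((α : Quaternion ℝ) + β • K) ^ n * a' n) +
            ((1 + I * K) / 2) *
              (∑ m ∈ Finset.range (M' + 1), ((α : Quaternion ℝ) - β • K) ^ m * b' m) := by
  intro K hK
  let L := max N M
  let A : ℕ → Quaternion ℝ := fun n => if n < N + 1 then a n else 0
  let B : ℕ → Quaternion ℝ := fun n => if n < M + 1 then b n else 0
  refine ⟨L, L, fun n => (2⁻¹ : ℝ) • (A n + B n + K * J * (B n - A n)),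
    fun n => (2⁻¹ : ℝ) • (A n + B n - K * J * (B n - A n)), fun α β I hβ hI => ?_⟩
  have hN : N + 1 ≤ L + 1 := Nat.succ_le_succ (le_max_left N M)
  have hM : M + 1 ≤ L + 1 := Nat.succ_le_succ (le_max_right N M)
  rw [hP α β I hβ hI, sum_range_mul_eq_sum_range_mul_ite hN,
    sum_range_mul_eq_sum_range_mul_ite hM, slicePolynomial_eq_sum_pow_mul hI hJ,
    slicePolynomial_eq_sum_pow_mul hI hK, ← sum_add_distrib, ← sum_add_distrib]
  refine sum_congr rfl fun n _ => ?_
  rw [← mul_add, ← mul_add]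
  exact congrArg _ (slice_coefficient_change_of_unit hK I J (A n) (B n))
end

section
/- Let α ∈ ℝ, β > 0 and v = α + iβ. The slice-polynomial function P is constant on the 2-sphere {α + βI : I ∈ 𝕊} if and only if g(v) = conj(ĝ(v)) and h(v) = conj(ĥ(v)); in that case its constant value on this sphere is g(v) + h(v)·j. -/
/-- The quaternion imaginary unit `i`. -/
noncomputable def qi : Quaternion ℝ := ⟨0, 1, 0, 0⟩

/-- The quaternion imaginary unit `j`. -/
noncomputable def qj : Quaternion ℝ := ⟨0, 0, 1, 0⟩

/-- Identification of ℂ with the slice ℂ_i of the quaternions. -/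
noncomputable def cq (z : ℂ) : Quaternion ℝ := ⟨z.re, z.im, 0, 0⟩

/-- The slice-polynomial function associated with complex polynomials `g, h, g', h'`,
evaluated at the quaternion `α + βI`. -/
noncomputable def Pslice (g h g' h' : Polynomial ℂ) (α β : ℝ) (I : Quaternion ℝ) : Quaternion ℝ :=
  ((1 - I * qi) / 2) * (cq (g.eval ⟨α, β⟩) + cq (h.eval ⟨α, β⟩) * qj) +
  ((1 + I * qi) / 2) *
    (cq ((starRingEnd ℂ) (g'.eval ⟨α, β⟩)) + cq ((starRingEnd ℂ) (h'.eval ⟨α, β⟩)) * qj)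

@[simp] theorem re_qi : qi.re = 0 := rfl
@[simp] theorem imI_qi : qi.imI = 1 := rfl
@[simp] theorem imJ_qi : qi.imJ = 0 := rfl
@[simp] theorem imK_qi : qi.imK = 0 := rfl

@[simp] theorem re_qj : qj.re = 0 := rfl
@[simp] theorem imI_qj : qj.imI = 0 := rfl
@[simp] theorem imJ_qj : qj.imJ = 1 := rfl
@[simp] theorem imK_qj : qj.imK = 0 := rfl

@[simp] theorem re_cq (z : ℂ) : (cq z).re = z.re := rfl
@[simp] theorem imI_cq (z : ℂ) : (cq z).imI = z.im := rfl
@[simp] theorem imJ_cq (z : ℂ) : (cq z).imJ = 0 := rfl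
@[simp] theorem imK_cq (z : ℂ) : (cq z).imK = 0 := rfl

theorem qi_mul_qi : qi * qi = -1 := by
  ext <;> simp [Quaternion.re_one, Quaternion.imI_one, Quaternion.imJ_one, Quaternion.imK_one]

theorem quaternion_one_add_one_div_two : (1 + 1 : Quaternion ℝ) / 2 = 1 := by
  have two_ne : (2 : Quaternion ℝ) ≠ 0 := by
    exact_mod_cast Quaternion.coe_injective.ne (two_ne_zero (α := ℝ))
  rw [one_add_one_eq_two, div_self two_ne]

/-- The pair of complex coordinates of a quaternion `z + w * j` is unique. -/
theorem cq_add_cq_mul_qj_inj {z w z' w' : ℂ} (e : cq z + cq w * qj = cq z' + cq w' * qj) :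
    z = z' ∧ w = w' := by
  rw [Quaternion.ext_iff] at e
  simp at e
  exact ⟨Complex.ext e.1 e.2.1, Complex.ext e.2.2.1 e.2.2.2⟩

theorem Pslice_qi (g h g' h' : Polynomial ℂ) (α β : ℝ) :
    Pslice g h g' h' α β qi = cq (g.eval ⟨α, β⟩) + cq (h.eval ⟨α, β⟩) * qj := by
  simp [Pslice, qi_mul_qi, quaternion_one_add_one_div_two]

theorem Pslice_neg_qi (g h g' h' : Polynomial ℂ) (α β : ℝ) :
    Pslice g h g' h' α β (-qi) =
      cq ((starRingEnd ℂ) (g'.eval ⟨α, β⟩)) + cq ((starRingEnd ℂ) (h'.eval ⟨α, β⟩)) * qj := by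
  simp [Pslice, qi_mul_qi, quaternion_one_add_one_div_two]

theorem Pslice_eq_of_eval_eq {g h g' h' : Polynomial ℂ} {α β : ℝ}
    (hg : g.eval ⟨α, β⟩ = (starRingEnd ℂ) (g'.eval ⟨α, β⟩))
    (hh : h.eval ⟨α, β⟩ = (starRingEnd ℂ) (h'.eval ⟨α, β⟩)) (I : Quaternion ℝ) :
    Pslice g h g' h' α β I = cq (g.eval ⟨α, β⟩) + cq (h.eval ⟨α, β⟩) * qj := by
  rw [Pslice, ← hg, ← hh, ← add_mul, ← add_div, sub_add_add_cancel,
    quaternion_one_add_one_div_two, one_mul]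

/-- The slice-polynomial function `P` is constant on the sphere `α + β𝕊` iff
`g(v) = conj (ĝ(v))` and `h(v) = conj (ĥ(v))` for `v = α + iβ`; in that case the constant
value is `g(v) + h(v)·j`. -/
theorem slicePolynomial_constant_on_sphere_iff (g h g' h' : Polynomial ℂ)
    (α β : ℝ) (hβ : 0 < β) :
    ((∀ I I' : Quaternion ℝ, I * I = -1 → I' * I' = -1 →
        Pslice g h g' h' α β I = Pslice g h g' h' α β I') ↔
      (g.eval ⟨α, β⟩ = (starRingEnd ℂ) (g'.eval ⟨α, β⟩) ∧
        h.eval ⟨α, β⟩ = (starRingEnd ℂ) (h'.eval ⟨α, β⟩))) ∧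
    ((g.eval ⟨α, β⟩ = (starRingEnd ℂ) (g'.eval ⟨α, β⟩) ∧
        h.eval ⟨α, β⟩ = (starRingEnd ℂ) (h'.eval ⟨α, β⟩)) →
      ∀ I : Quaternion ℝ, I * I = -1 →
        Pslice g h g' h' α β I = cq (g.eval ⟨α, β⟩) + cq (h.eval ⟨α, β⟩) * qj) := by
  refine ⟨⟨fun H => ?_, fun ⟨hg, hh⟩ I I' _ _ => ?_⟩,
    fun ⟨hg, hh⟩ I _ => Pslice_eq_of_eval_eq hg hh I⟩
  · have e := H qi (-qi) qi_mul_qi (by rw [neg_mul_neg, qi_mul_qi])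
    rw [Pslice_qi, Pslice_neg_qi] at e
    exact cq_add_cq_mul_qj_inj e
  · rw [Pslice_eq_of_eval_eq hg hh, Pslice_eq_of_eval_eq hg hh]
end

section
/- Let A, B, C be real numbers with A² + B² + C² = 1, A ≠ 1 and A ≠ −1, and set u = −i(B+Ci)/(1+A) and w = i(B+Ci)/(1−A) in ℂ. Then for X ∈ ℂ the equation (B−Ci)X² − 2AiX + (B+Ci) = 0 holds if and only if X = u or X = w; moreover u ≠ 0 and w = −1/conj(u). (These are the two parameters of the intersection of the twistor fibre over α + (Ai+Bj+Ck)β, β > 0, with the Segre quadric X₀X₃ = X₁X₂.) -/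
/-- The two parameters of the intersection of the twistor fibre over
`α + (Ai+Bj+Ck)β` (with `β > 0`) with the Segre quadric. -/
theorem twistor_fibre_quadric_intersection (A B C : ℝ)
    (h1 : A ^ 2 + B ^ 2 + C ^ 2 = 1) (hA1 : A ≠ 1) (hA2 : A ≠ -1)
    (u w : ℂ)
    (hu : u = -Complex.I * ((B : ℂ) + (C : ℂ) * Complex.I) / (1 + (A : ℂ)))
    (hw : w = Complex.I * ((B : ℂ) + (C : ℂ) * Complex.I) / (1 - (A : ℂ))) :
    (∀ X : ℂ,
      ((B : ℂ) - (C : ℂ) * Complex.I) * X ^ 2 - 2 * (A : ℂ) * Complex.I * X +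
          ((B : ℂ) + (C : ℂ) * Complex.I) = 0 ↔ X = u ∨ X = w) ∧
    u ≠ 0 ∧ w = -1 / (starRingEnd ℂ) u := by
  have hI : Complex.I ^ 2 = -1 := Complex.I_sq
  have hp : (1 + (A : ℂ)) ≠ 0 := by
    intro h
    apply hA2
    have : (1 + A : ℝ) = 0 := by exact_mod_cast h
    linarith
  have hm : (1 - (A : ℂ)) ≠ 0 := by
    intro h
    apply hA1
    have : (1 - A : ℝ) = 0 := by exact_mod_cast h
    linarith
  have h1' : (A : ℂ) ^ 2 + (B : ℂ) ^ 2 + (C : ℂ) ^ 2 = 1 := by exact_mod_cast h1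
  have hconj : (starRingEnd ℂ) u =
      Complex.I * ((B : ℂ) - (C : ℂ) * Complex.I) / (1 + (A : ℂ)) := by
    rw [hu]
    simp [sub_eq_add_neg]
  have hprod : ((B : ℂ) + (C : ℂ) * Complex.I) * ((B : ℂ) - (C : ℂ) * Complex.I) =
      (1 - (A : ℂ)) * (1 + (A : ℂ)) := by
    linear_combination h1' - (C : ℂ) ^ 2 * hI
  generalize (B : ℂ) + (C : ℂ) * Complex.I = z at *
  generalize (B : ℂ) - (C : ℂ) * Complex.I = z' at *
  have hzz : z * z' ≠ 0 := hprod ▸ mul_ne_zero hm hp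
  have hz : z ≠ 0 := left_ne_zero_of_mul hzz
  have hz' : z' ≠ 0 := right_ne_zero_of_mul hzz
  have hu' : z' * u = -Complex.I * (1 - (A : ℂ)) := by
    rw [hu]
    field_simp
    linear_combination -hprod
  have hw' : z' * w = Complex.I * (1 + (A : ℂ)) := by
    rw [hw]
    field_simp
    linear_combination hprod
  refine ⟨fun X => ?_, ?_, ?_⟩
  · have hfactor : z' * X ^ 2 - 2 * (A : ℂ) * Complex.I * X + z =
        z' * ((X - u) * (X - w)) := by
      apply mul_left_cancel₀ hz'
      linear_combination X * z' * hu' + X * z' * hw' - z' * w * hu' +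
        Complex.I * (1 - (A : ℂ)) * hw' + hprod + (1 - (A : ℂ)) * (1 + (A : ℂ)) * hI
    rw [hfactor, mul_eq_zero, mul_eq_zero, sub_eq_zero, sub_eq_zero]
    exact or_iff_right hz'
  · rw [hu]
    exact div_ne_zero (mul_ne_zero (neg_ne_zero.mpr Complex.I_ne_zero) hz) hp
  · rw [hconj]
    apply mul_left_cancel₀ hz'
    rw [hw']
    have hI0 := Complex.I_ne_zero
    field_simp
    linear_combination hI
end

section
/- Let q₁, q₂ ∈ ℂ, q = q₁ + q₂·j, and suppose the polynomial D_q is identically zero. Then for every v = α + iβ with β > 0 such that A_q(v) ≠ 0 there exists a unique I ∈ 𝕊 with P(α + βI) = q, and for every v = α − iβ with β > 0 such that A_q(v) ≠ 0 there exists a unique I ∈ 𝕊 with P∨(α + βI) = q. (Thus P and P∨ are each constantly equal to q along a surface, a 'wing'.) -/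
/-- The companion slice-polynomial function at `α + βI` (`β > 0`), using `v̄ = α - iβ`. -/
noncomputable def Pveeslice (g h g' h' : Polynomial ℂ) (α β : ℝ) (I : Quaternion ℝ) :
    Quaternion ℝ :=
  ((1 - I * qi) / 2) *
    (cq ((starRingEnd ℂ) (g'.eval ⟨α, -β⟩)) + cq ((starRingEnd ℂ) (h'.eval ⟨α, -β⟩)) * qj) +
  ((1 + I * qi) / 2) * (cq (g.eval ⟨α, -β⟩) + cq (h.eval ⟨α, -β⟩) * qj)

@[simp]
lemma qi_components : qi.re = 0 ∧ qi.imI = 1 ∧ qi.imJ = 0 ∧ qi.imK = 0 :=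
  ⟨rfl, rfl, rfl, rfl⟩

@[simp]
lemma qj_components : qj.re = 0 ∧ qj.imI = 0 ∧ qj.imJ = 1 ∧ qj.imK = 0 :=
  ⟨rfl, rfl, rfl, rfl⟩

@[simp]
lemma cq_components (z : ℂ) :
    (cq z).re = z.re ∧ (cq z).imI = z.im ∧ (cq z).imJ = 0 ∧ (cq z).imK = 0 :=
  ⟨rfl, rfl, rfl, rfl⟩

@[simp]
lemma quaternion_zero_components : (0 : Quaternion ℝ).re = 0 ∧ (0 : Quaternion ℝ).imI = 0 ∧
    (0 : Quaternion ℝ).imJ = 0 ∧ (0 : Quaternion ℝ).imK = 0 :=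
  ⟨rfl, rfl, rfl, rfl⟩

/-- The unit `i` is nonzero. -/
lemma qi_ne_zero : qi ≠ 0 := fun h => by
  have him : qi.imI = (0 : Quaternion ℝ).imI := by rw [h]
  simp at him

/-- A quaternion with zero real part and norm one squares to `-1`. -/
lemma mul_self_eq_neg_one_of_re_eq_zero {I : Quaternion ℝ} (hre : I.re = 0)
    (hnorm : Quaternion.normSq I = 1) : I * I = -1 := by
  have hstar : star I = -I := Quaternion.star_eq_neg.mpr hre
  rw [← neg_eq_iff_eq_neg, ← mul_neg, ← hstar, Quaternion.self_mul_star, hnorm, Quaternion.coe_one]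

/-- The equation `(1 - I i) / 2 * A + (1 + I i) / 2 * B = q` as a linear equation in `I`. -/
lemma slice_eq_iff (A B q I : Quaternion ℝ) :
    (1 - I * qi) / 2 * A + (1 + I * qi) / 2 * B = q ↔
      I * (qi * ((B - q) - (A - q))) = -((A - q) + (B - q)) := by
  have half : ∀ x : Quaternion ℝ, x / 2 = (1 / 2 : ℝ) • x := fun x => by
    rw [div_eq_mul_inv, show (2 : Quaternion ℝ)⁻¹ = ((1 / 2 : ℝ) : Quaternion ℝ) by
      rw [one_div, Quaternion.coe_inv]
      exact congrArg _ (map_ofNat (algebraMap ℝ (Quaternion ℝ)) 2).symm, Quaternion.mul_coe_eq_smul]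
  have key : I * (qi * ((B - q) - (A - q))) + ((A - q) + (B - q)) =
      (2 : ℝ) • ((1 - I * qi) / 2 * A + (1 + I * qi) / 2 * B - q) := by
    rw [half, half, smul_mul_assoc, smul_mul_assoc, smul_sub, smul_add, smul_smul, smul_smul,
      two_smul ℝ q]
    norm_num
    noncomm_ring
  rw [eq_neg_iff_add_eq_zero, key, smul_eq_zero_iff_right two_ne_zero, sub_eq_zero]

/-- If `A - q` and `B - q` are Hermitian orthogonal over the slice `ℂ_i` and not both zero, then
exactly one imaginary unit `I` satisfies `(1 - I i) / 2 * A + (1 + I i) / 2 * B = q`. -/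
lemma existsUnique_unit_slice_eq (A B q : Quaternion ℝ)
    (hre : ((A - q) * star (B - q)).re = 0) (him : ((A - q) * star (B - q)).imI = 0)
    (hne : ¬(A - q = 0 ∧ B - q = 0)) :
    ∃! I : Quaternion ℝ, I * I = -1 ∧ (1 - I * qi) / 2 * A + (1 + I * qi) / 2 * B = q := by
  simp only [slice_eq_iff]
  generalize A - q = U at *
  generalize B - q = V at *
  have hnorm : Quaternion.normSq (U + V) = Quaternion.normSq (qi * (V - U)) := by
    simp [Quaternion.normSq_def'] at hre ⊢
    linear_combination 4 * hre
  have hW : qi * (V - U) ≠ 0 := fun h0 => by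
    have hsum : U + V = 0 := Quaternion.normSq_eq_zero.mp (by rw [hnorm, h0, map_zero])
    have hdiff : V - U = 0 :=
      (mul_eq_zero.mp h0).resolve_left qi_ne_zero
    have hVU : V = U := sub_eq_zero.mp hdiff
    have hU : U = 0 := by
      rw [hVU, ← two_smul ℝ U] at hsum
      exact (smul_eq_zero_iff_right two_ne_zero).mp hsum
    exact hne ⟨hU, hVU.trans hU⟩
  have horth : ((U + V) * star (qi * (V - U))).re = 0 := by
    simp at him ⊢
    linear_combination 2 * him
  generalize qi * (V - U) = W at *
  refine ⟨-(U + V) * W⁻¹, ⟨mul_self_eq_neg_one_of_re_eq_zero ?_ ?_, ?_⟩, ?_⟩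
  · rw [Quaternion.inv_def, mul_smul_comm, neg_mul, Quaternion.re_smul, Quaternion.re_neg, horth,
      neg_zero, smul_zero]
  · rw [map_mul, map_inv₀, Quaternion.normSq_neg, hnorm]
    exact mul_inv_cancel₀ (Quaternion.normSq_ne_zero.mpr hW)
  · exact inv_mul_cancel_right₀ hW _
  · rintro I ⟨-, hI⟩
    exact (eq_mul_inv_iff_mul_eq₀ hW).mpr hI

/-- Vanishing of the determinant expresses Hermitian orthogonality of the two stem values. -/
lemma orthogonal_of_det_eq_zero {a b c d q₁ q₂ : ℂ}
    (hD : -(a - q₁) * ((starRingEnd ℂ) q₁ - c) + (b - q₂) * (d - (starRingEnd ℂ) q₂) = 0) :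
    (((cq a + cq b * qj) - (cq q₁ + cq q₂ * qj)) * star ((cq ((starRingEnd ℂ) c) +
      cq ((starRingEnd ℂ) d) * qj) - (cq q₁ + cq q₂ * qj))).re = 0 ∧
    (((cq a + cq b * qj) - (cq q₁ + cq q₂ * qj)) * star ((cq ((starRingEnd ℂ) c) +
      cq ((starRingEnd ℂ) d) * qj) - (cq q₁ + cq q₂ * qj))).imI = 0 := by
  have hre := congrArg Complex.re hD
  have him := congrArg Complex.im hD
  simp only [Complex.add_re, Complex.add_im, Complex.mul_re, Complex.mul_im, Complex.neg_re,
    Complex.neg_im, Complex.sub_re, Complex.sub_im, Complex.conj_re, Complex.conj_im,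
    Complex.zero_re, Complex.zero_im] at hre him
  constructor
  · simp
    linear_combination hre
  · simp
    linear_combination him

/-- If both stem values equal `q`, then all entries of the matrix `A_q` vanish. -/
lemma entries_eq_zero {a b c d q₁ q₂ : ℂ}
    (hab : (cq a + cq b * qj) - (cq q₁ + cq q₂ * qj) = 0)
    (hcd : (cq ((starRingEnd ℂ) c) + cq ((starRingEnd ℂ) d) * qj) - (cq q₁ + cq q₂ * qj) = 0) :
    a - q₁ = 0 ∧ -d + (starRingEnd ℂ) q₂ = 0 ∧ b - q₂ = 0 ∧ -(starRingEnd ℂ) q₁ + c = 0 := by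
  simp only [Quaternion.ext_iff] at hab hcd
  simp at hab hcd
  simp only [Complex.ext_iff]
  simp
  obtain ⟨h1, h2, h3, h4⟩ := hab
  obtain ⟨h5, h6, h7, h8⟩ := hcd
  refine ⟨⟨?_, ?_⟩, ⟨?_, ?_⟩, ⟨?_, ?_⟩, ⟨?_, ?_⟩⟩ <;> linarith

/-- If the determinant `D_q` vanishes identically, then `P` (resp. `P∨`) takes the value
`q = q₁ + q₂ j` at a unique point of each sphere `α + β𝕊` for which `A_q(α+iβ) ≠ 0`
(resp. `A_q(α-iβ) ≠ 0`): the preimage is a wing. -/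
theorem det_identically_zero_gives_wing (g h g' h' : Polynomial ℂ) (q₁ q₂ : ℂ)
    (hD : ∀ v : ℂ,
      -(g.eval v - q₁) * ((starRingEnd ℂ) q₁ - g'.eval v) +
        (h.eval v - q₂) * (h'.eval v - (starRingEnd ℂ) q₂) = 0) :
    (∀ α β : ℝ, 0 < β →
      ¬(g.eval ⟨α, β⟩ - q₁ = 0 ∧ -h'.eval ⟨α, β⟩ + (starRingEnd ℂ) q₂ = 0 ∧
          h.eval ⟨α, β⟩ - q₂ = 0 ∧ -(starRingEnd ℂ) q₁ + g'.eval ⟨α, β⟩ = 0) →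
      ∃! I : Quaternion ℝ, I * I = -1 ∧
        Pslice g h g' h' α β I = cq q₁ + cq q₂ * qj) ∧
    (∀ α β : ℝ, 0 < β →
      ¬(g.eval ⟨α, -β⟩ - q₁ = 0 ∧ -h'.eval ⟨α, -β⟩ + (starRingEnd ℂ) q₂ = 0 ∧
          h.eval ⟨α, -β⟩ - q₂ = 0 ∧ -(starRingEnd ℂ) q₁ + g'.eval ⟨α, -β⟩ = 0) →
      ∃! I : Quaternion ℝ, I * I = -1 ∧
        Pveeslice g h g' h' α β I = cq q₁ + cq q₂ * qj) := by
  refine ⟨fun α β _ hA => ?_, fun α β _ hA => ?_⟩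
  · obtain ⟨hre, him⟩ := orthogonal_of_det_eq_zero (hD ⟨α, β⟩)
    exact existsUnique_unit_slice_eq _ _ _ hre him fun h => hA (entries_eq_zero h.1 h.2)
  · obtain ⟨hre, him⟩ := orthogonal_of_det_eq_zero (hD ⟨α, -β⟩)
    refine existsUnique_unit_slice_eq _ _ _ ?_ ?_ fun h => hA (entries_eq_zero h.2 h.1)
    · rw [← star_mul_star, Quaternion.re_star, hre]
    · rw [← star_mul_star, Quaternion.imI_star, him, neg_zero]
end

section
/- Consider the map ℛ sending a pair of nonzero vectors (s,u), (t,v) ∈ ℂ²∖{(0,0)} with (st², ut², −sv², uvt) ≠ (0,0,0,0) to the point [st² : ut² : −sv² : uvt] ∈ ℂP³. The image of ℛ is exactly (𝒞 ∖ m₀₁) ∪ {[0:0:1:0]}, where m₀₁ = {[X] ∈ ℂP³ : X₀ = 0 and X₁ = 0}. Equivalently: every value of ℛ lies on 𝒞, and a point [X₀:X₁:X₂:X₃] of 𝒞 is a value of ℛ if and only if (X₀,X₁) ≠ (0,0) or [X₀:X₁:X₂:X₃] = [0:0:1:0]. -/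
/-- The image of the parameterisation `ℛ([s:u],[t:v]) = [st² : ut² : −sv² : uvt]` is
exactly `(𝒞 ∖ m₀₁) ∪ {[0:0:1:0]}`, where `𝒞` is the cubic scroll `X₀X₃² + X₁²X₂ = 0`
and `m₀₁ = {X₀ = X₁ = 0}`. -/
theorem image_of_cubic_scroll_parameterisation :
    (∀ s u t v : ℂ, ¬(s = 0 ∧ u = 0) → ¬(t = 0 ∧ v = 0) →
      (s * t ^ 2) * (u * v * t) ^ 2 + (u * t ^ 2) ^ 2 * (-(s * v ^ 2)) = 0) ∧
    (∀ X₀ X₁ X₂ X₃ : ℂ, ¬(X₀ = 0 ∧ X₁ = 0 ∧ X₂ = 0 ∧ X₃ = 0) →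
      X₀ * X₃ ^ 2 + X₁ ^ 2 * X₂ = 0 →
      ((∃ s u t v lam : ℂ, lam ≠ 0 ∧ ¬(s = 0 ∧ u = 0) ∧ ¬(t = 0 ∧ v = 0) ∧
          s * t ^ 2 = lam * X₀ ∧ u * t ^ 2 = lam * X₁ ∧
          -(s * v ^ 2) = lam * X₂ ∧ u * v * t = lam * X₃) ↔
        (¬(X₀ = 0 ∧ X₁ = 0) ∨ (X₀ = 0 ∧ X₁ = 0 ∧ X₃ = 0 ∧ X₂ ≠ 0)))) := by
  refine ⟨fun s u t v _ _ => by ring, fun X₀ X₁ X₂ X₃ hX hC => ⟨?_, ?_⟩⟩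
  · rintro ⟨s, u, t, v, lam, hlam, hsu, -, h₀, h₁, -, h₃⟩
    by_cases h : X₀ = 0 ∧ X₁ = 0
    · obtain ⟨rfl, rfl⟩ := h
      have ht : t = 0 := by
        by_contra ht
        exact hsu ⟨by simpa [ht] using h₀, by simpa [ht] using h₁⟩
      have hX₃ : X₃ = 0 := by simpa [ht, hlam, eq_comm] using h₃
      exact Or.inr ⟨rfl, rfl, hX₃, fun hX₂ => hX ⟨rfl, rfl, hX₂, hX₃⟩⟩
    · exact Or.inl h
  · rintro (h | ⟨rfl, rfl, rfl, hX₂⟩)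
    · by_cases hX₁ : X₁ = 0
      · subst hX₁
        have hX₀ : X₀ ≠ 0 := fun h₀ => h ⟨h₀, rfl⟩
        have hX₃ : X₃ = 0 := by simpa [hX₀] using hC
        obtain ⟨v, hv⟩ := IsAlgClosed.exists_pow_nat_eq (-X₂ / X₀) two_pos
        refine ⟨X₀, 0, 1, v, 1, one_ne_zero, by simp [hX₀], by simp, by ring, by ring, ?_,
          by simp [hX₃]⟩
        rw [hv]
        field_simp
      · refine ⟨X₀, X₁, 1, X₃ / X₁, 1, one_ne_zero, by simp [hX₁], by simp, by ring, by ring,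
          ?_, by field_simp⟩
        field_simp
        linear_combination -hC
    · exact ⟨-X₂, 0, 0, 1, 1, one_ne_zero, by simp [hX₂], by simp, by simp, by simp, by simp,
        by simp⟩
end

section
/- Let X₀, X₂ ∈ ℂ∖{0}. The set of preimages of the point [X₀ : 0 : X₂ : 0] ∈ ℂP³ under the map ℛ([s:u],[t:v]) = [st² : ut² : −sv² : uvt] has exactly two elements in ℂP¹ × ℂP¹; that is, there are exactly two classes of pairs ((s,u),(t,v)) of nonzero vectors, up to independent nonzero rescaling of (s,u) and of (t,v), such that (st², ut², −sv², uvt) is a nonzero complex multiple of (X₀, 0, X₂, 0). (Points of the double line m₁₃ of 𝒞 away from the cuspidal points have exactly two preimages.) -/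
/-- A point `[X₀ : 0 : X₂ : 0]` with `X₀, X₂ ≠ 0` (a point of the double line `m₁₃` of the
cubic scroll away from the cuspidal points) has exactly two preimages in `ℂP¹ × ℂP¹` under
`ℛ([s:u],[t:v]) = [st² : ut² : −sv² : uvt]`: there are two solutions, inequivalent under
independent rescaling of `(s,u)` and `(t,v)`, such that every solution is equivalent to
one of them. -/
theorem double_line_has_two_preimages (X₀ X₂ : ℂ) (hX₀ : X₀ ≠ 0) (hX₂ : X₂ ≠ 0) :
    ∃ s u t v s' u' t' v' : ℂ,
      (¬(s = 0 ∧ u = 0) ∧ ¬(t = 0 ∧ v = 0) ∧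
        ∃ lam : ℂ, lam ≠ 0 ∧ s * t ^ 2 = lam * X₀ ∧ u * t ^ 2 = 0 ∧
          -(s * v ^ 2) = lam * X₂ ∧ u * v * t = 0) ∧
      (¬(s' = 0 ∧ u' = 0) ∧ ¬(t' = 0 ∧ v' = 0) ∧
        ∃ lam : ℂ, lam ≠ 0 ∧ s' * t' ^ 2 = lam * X₀ ∧ u' * t' ^ 2 = 0 ∧
          -(s' * v' ^ 2) = lam * X₂ ∧ u' * v' * t' = 0) ∧
      ¬(∃ μ ν : ℂ, μ ≠ 0 ∧ ν ≠ 0 ∧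
          s' = μ * s ∧ u' = μ * u ∧ t' = ν * t ∧ v' = ν * v) ∧
      (∀ s'' u'' t'' v'' : ℂ,
        (¬(s'' = 0 ∧ u'' = 0) ∧ ¬(t'' = 0 ∧ v'' = 0) ∧
          ∃ lam : ℂ, lam ≠ 0 ∧ s'' * t'' ^ 2 = lam * X₀ ∧ u'' * t'' ^ 2 = 0 ∧
            -(s'' * v'' ^ 2) = lam * X₂ ∧ u'' * v'' * t'' = 0) →
        ((∃ μ ν : ℂ, μ ≠ 0 ∧ ν ≠ 0 ∧
            s'' = μ * s ∧ u'' = μ * u ∧ t'' = ν * t ∧ v'' = ν * v) ∨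
          (∃ μ ν : ℂ, μ ≠ 0 ∧ ν ≠ 0 ∧
            s'' = μ * s' ∧ u'' = μ * u' ∧ t'' = ν * t' ∧ v'' = ν * v'))) := by
  obtain ⟨w, hw⟩ := IsAlgClosed.exists_pow_nat_eq (-X₂ / X₀) two_pos
  have hwX : w ^ 2 * X₀ = -X₂ := by rw [hw]; field_simp
  have hw0 : w ≠ 0 := by
    rintro rfl
    exact hX₂ (by linear_combination hwX)
  refine ⟨1, 0, 1, w, 1, 0, 1, -w,
    ⟨by simp, by simp, X₀⁻¹, inv_ne_zero hX₀, ?_, by simp, ?_, by simp⟩,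
    ⟨by simp, by simp, X₀⁻¹, inv_ne_zero hX₀, ?_, by simp, ?_, by simp⟩, ?_, ?_⟩
  · field_simp
  · field_simp
    linear_combination -hwX
  · field_simp
  · field_simp
    linear_combination -hwX
  · rintro ⟨μ, ν, -, -, -, -, hν, hv⟩
    exact hw0 (by linear_combination (-1 / 2 : ℂ) * hv + w / 2 * hν)
  · rintro s u t v ⟨-, -, lam, hlam, h₀, h₁, h₂, -⟩
    have hst : s * t ^ 2 ≠ 0 := h₀ ▸ mul_ne_zero hlam hX₀
    have hs : s ≠ 0 := left_ne_zero_of_mul hst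
    have ht2 : t ^ 2 ≠ 0 := right_ne_zero_of_mul hst
    have ht : t ≠ 0 := ne_zero_pow two_ne_zero ht2
    have hu : u = 0 := (mul_eq_zero.mp h₁).resolve_right ht2
    have hv : v ^ 2 = (t * w) ^ 2 :=
      mul_left_cancel₀ (mul_ne_zero hs hX₀)
        (by linear_combination -X₀ * h₂ + X₂ * h₀ - s * t ^ 2 * hwX)
    rcases sq_eq_sq_iff_eq_or_eq_neg.mp hv with h | h
    · exact Or.inl ⟨s, t, hs, ht, by simp, by simp [hu], by simp, h⟩
    · exact Or.inr ⟨s, t, hs, ht, by simp, by simp [hu], by simp, by simp [h]⟩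
end

section
/- Let q₁, q₂ ∈ ℂ. The identity X₀·(X₀q₂ + X₁·conj(q₁))² + X₁²·(X₀q₁ − X₁·conj(q₂)) = 0 holds for all X₀, X₁ ∈ ℂ if and only if q₂ = 0 and q₁ + conj(q₁)² = 0. (Equivalently, the twistor fibre over the quaternion q₁ + q₂j is entirely contained in the cubic scroll 𝒞 exactly for these values of q₁, q₂.) -/
/-- The twistor fibre over the quaternion `q₁ + q₂ j` is entirely contained in the cubic
scroll `X₀X₃² + X₁²X₂ = 0` iff `q₂ = 0` and `q₁ + conj(q₁)² = 0`. -/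
theorem fibre_contained_in_scroll_iff (q₁ q₂ : ℂ) :
    (∀ X₀ X₁ : ℂ,
      X₀ * (X₀ * q₂ + X₁ * (starRingEnd ℂ) q₁) ^ 2 +
        X₁ ^ 2 * (X₀ * q₁ - X₁ * (starRingEnd ℂ) q₂) = 0) ↔
    (q₂ = 0 ∧ q₁ + ((starRingEnd ℂ) q₁) ^ 2 = 0) := by
  constructor
  · intro h
    have hq₂ : q₂ = 0 := by simpa using h 1 0
    subst hq₂
    refine ⟨rfl, ?_⟩
    have h₁ := h 1 1
    simp only [map_zero] at h₁
    linear_combination h₁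
  · rintro ⟨rfl, h⟩ X₀ X₁
    rw [map_zero]
    linear_combination X₀ * X₁ ^ 2 * h
end

section
/- For real numbers x, z, the equation 27z⁴ + 4x²(9+x)·z² + 4x³(x+1)² = 0 holds if and only if x ≤ 0 and z² = (2/27)·(−x²(9+x) + √(x⁴(9+x)² − 27x³(x+1)²)); in particular every real solution has x ≤ 0, for every x ≤ 0 the quantity under the square root is nonnegative and there exists a real solution z, and the only solutions with z = 0 are (x,z) = (0,0) and (x,z) = (−1,0). (This curve, with z = |q₂|, describes a handle of the twistor discriminant locus of the cubic scroll 𝒞.) -/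
/-- For `x ≤ 0` the radicand of the quadratic formula is a sum of nonnegative terms. -/
lemma handle_radicand_nonneg {x : ℝ} (hx : x ≤ 0) :
    0 ≤ x ^ 4 * (9 + x) ^ 2 - 27 * x ^ 3 * (x + 1) ^ 2 := by
  have h₁ : 0 ≤ (-x) ^ 3 * (x + 1) ^ 2 :=
    mul_nonneg (pow_nonneg (neg_nonneg.mpr hx) 3) (sq_nonneg _)
  have h₂ : 0 ≤ (x ^ 2 * (9 + x)) ^ 2 := sq_nonneg _
  linarith

lemma handle_nonpos {x z : ℝ}
    (h : 27 * z ^ 4 + 4 * x ^ 2 * (9 + x) * z ^ 2 + 4 * x ^ 3 * (x + 1) ^ 2 = 0) :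
    x ≤ 0 := by
  by_contra! hx
  have : 0 < 27 * z ^ 4 + 4 * x ^ 2 * (9 + x) * z ^ 2 + 4 * x ^ 3 * (x + 1) ^ 2 := by
    positivity
  exact this.ne' h

/-- The square of the second coordinate is the larger root of the quadratic. -/
lemma handle_half_deriv_nonneg {x z : ℝ}
    (h : 27 * z ^ 4 + 4 * x ^ 2 * (9 + x) * z ^ 2 + 4 * x ^ 3 * (x + 1) ^ 2 = 0) :
    0 ≤ 27 * z ^ 2 + 2 * (x ^ 2 * (9 + x)) := by
  rcases eq_or_ne z 0 with rfl | hz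
  · have hx : x = 0 ∨ x + 1 = 0 := by simpa using h
    rcases hx with rfl | hx
    · simp
    · rw [eq_neg_of_add_eq_zero_left hx]
      norm_num
  · have hz : 0 < z ^ 2 := by positivity
    have h₁ : 0 ≤ (-x) ^ 3 * (x + 1) ^ 2 :=
      mul_nonneg (pow_nonneg (neg_nonneg.mpr (handle_nonpos h)) 3) (sq_nonneg _)
    have h₂ : 0 ≤ z ^ 2 * (27 * z ^ 2 + 4 * (x ^ 2 * (9 + x))) := by linarith
    linarith [nonneg_of_mul_nonneg_right h₂ hz]

lemma handle_eq_zero_of_sq_eq {x z : ℝ} (hx : x ≤ 0)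
    (hz : z ^ 2 = (2 / 27) * (-(x ^ 2 * (9 + x)) +
      Real.sqrt (x ^ 4 * (9 + x) ^ 2 - 27 * x ^ 3 * (x + 1) ^ 2))) :
    27 * z ^ 4 + 4 * x ^ 2 * (9 + x) * z ^ 2 + 4 * x ^ 3 * (x + 1) ^ 2 = 0 := by
  have hs := Real.sq_sqrt (handle_radicand_nonneg hx)
  rw [show z ^ 4 = (z ^ 2) ^ 2 by ring, hz]
  linear_combination (4 / 27) * hs

lemma handle_sq_eq {x z : ℝ}
    (h : 27 * z ^ 4 + 4 * x ^ 2 * (9 + x) * z ^ 2 + 4 * x ^ 3 * (x + 1) ^ 2 = 0) :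
    z ^ 2 = (2 / 27) * (-(x ^ 2 * (9 + x)) +
      Real.sqrt (x ^ 4 * (9 + x) ^ 2 - 27 * x ^ 3 * (x + 1) ^ 2)) := by
  have hr : x ^ 4 * (9 + x) ^ 2 - 27 * x ^ 3 * (x + 1) ^ 2 =
      ((27 * z ^ 2 + 2 * (x ^ 2 * (9 + x))) / 2) ^ 2 := by
    linear_combination (-27 / 4) * h
  rw [hr, Real.sqrt_sq (div_nonneg (handle_half_deriv_nonneg h) two_pos.le)]
  ring

lemma handle_root_nonneg {x : ℝ} (hx : x ≤ 0) :
    0 ≤ (2 / 27) * (-(x ^ 2 * (9 + x)) +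
      Real.sqrt (x ^ 4 * (9 + x) ^ 2 - 27 * x ^ 3 * (x + 1) ^ 2)) := by
  have h₁ : 0 ≤ (-x) ^ 3 * (x + 1) ^ 2 :=
    mul_nonneg (pow_nonneg (neg_nonneg.mpr hx) 3) (sq_nonneg _)
  have h₂ : x ^ 2 * (9 + x) ≤
      Real.sqrt (x ^ 4 * (9 + x) ^ 2 - 27 * x ^ 3 * (x + 1) ^ 2) :=
    Real.le_sqrt_of_sq_le (by linarith)
  linarith

/-- Description of the real curve `27z⁴ + 4x²(9+x)z² + 4x³(x+1)² = 0` (a handle of the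
twistor discriminant locus of the cubic scroll): solutions have `x ≤ 0` and
`z² = (2/27)(−x²(9+x) + √(x⁴(9+x)² − 27x³(x+1)²))`; for every `x ≤ 0` the radicand is
nonnegative and a real solution `z` exists; and the only solutions with `z = 0` are
`(0,0)` and `(−1,0)`. -/
theorem handle_curve_description :
    (∀ x z : ℝ,
      27 * z ^ 4 + 4 * x ^ 2 * (9 + x) * z ^ 2 + 4 * x ^ 3 * (x + 1) ^ 2 = 0 ↔
        (x ≤ 0 ∧ z ^ 2 = (2 / 27) * (-(x ^ 2 * (9 + x)) +
          Real.sqrt (x ^ 4 * (9 + x) ^ 2 - 27 * x ^ 3 * (x + 1) ^ 2)))) ∧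
    (∀ x : ℝ, x ≤ 0 →
      0 ≤ x ^ 4 * (9 + x) ^ 2 - 27 * x ^ 3 * (x + 1) ^ 2 ∧
      ∃ z : ℝ, 27 * z ^ 4 + 4 * x ^ 2 * (9 + x) * z ^ 2 + 4 * x ^ 3 * (x + 1) ^ 2 = 0) ∧
    (∀ x z : ℝ,
      (27 * z ^ 4 + 4 * x ^ 2 * (9 + x) * z ^ 2 + 4 * x ^ 3 * (x + 1) ^ 2 = 0 ∧ z = 0) ↔
        ((x = 0 ∧ z = 0) ∨ (x = -1 ∧ z = 0))) := by
  refine ⟨fun x z => ⟨fun h => ⟨handle_nonpos h, handle_sq_eq h⟩,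
    fun h => handle_eq_zero_of_sq_eq h.1 h.2⟩, fun x hx => ⟨handle_radicand_nonneg hx,
    _, handle_eq_zero_of_sq_eq hx (Real.sq_sqrt (handle_root_nonneg hx))⟩, fun x z => ?_⟩
  constructor
  · rintro ⟨h, rfl⟩
    have hx : x = 0 ∨ x + 1 = 0 := by simpa using h
    exact hx.imp (fun hx => ⟨hx, rfl⟩) (fun hx => ⟨eq_neg_of_add_eq_zero_left hx, rfl⟩)
  · rintro (⟨rfl, rfl⟩ | ⟨rfl, rfl⟩) <;> norm_num
end

section
/- Let X = (X₀, X₁, X₂, X₃) ∈ ℂ⁴. Then X₀X₃² + X₁²X₂ = 0 and X₀²X₃ + X₁X₂² = 0 hold simultaneously if and only if at least one of the following holds: (X₀ = 0 and X₁ = 0), or (X₀ = 0 and X₂ = 0), or (X₁ = 0 and X₃ = 0), or (X₂ = 0 and X₃ = 0), or there exists ζ ∈ ℂ with ζ³ = −1, X₃ = ζ·X₁ and X₂ = −ζ²·X₀. (This describes the intersection of the cubic scroll 𝒞 with its image under the twistor involution j: it is the union of the four coordinate lines m₀₁, m₀₂, m₁₃, m₂₃ and three further lines lying over the cube roots of −1.)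 -/
/-- The intersection of the cubic scroll `X₀X₃² + X₁²X₂ = 0` with its image
`X₀²X₃ + X₁X₂² = 0` under the twistor involution `j`: it is the union of the four
coordinate lines `m₀₁, m₀₂, m₁₃, m₂₃` and three further lines lying over the cube roots
of `−1`. -/
theorem scroll_inter_jscroll (X₀ X₁ X₂ X₃ : ℂ) :
    (X₀ * X₃ ^ 2 + X₁ ^ 2 * X₂ = 0 ∧ X₀ ^ 2 * X₃ + X₁ * X₂ ^ 2 = 0) ↔
    ((X₀ = 0 ∧ X₁ = 0) ∨ (X₀ = 0 ∧ X₂ = 0) ∨ (X₁ = 0 ∧ X₃ = 0) ∨ (X₂ = 0 ∧ X₃ = 0) ∨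
      ∃ ζ : ℂ, ζ ^ 3 = -1 ∧ X₃ = ζ * X₁ ∧ X₂ = -ζ ^ 2 * X₀) := by
  constructor
  · rintro ⟨h, hj⟩
    by_cases h₀ : X₀ = 0
    · subst h₀
      have : X₁ = 0 ∨ X₂ = 0 := by simpa using h
      tauto
    by_cases h₁ : X₁ = 0
    · subst h₁
      have : X₃ = 0 := by simpa [h₀] using h
      tauto
    obtain ⟨ζ, rfl⟩ : ∃ ζ, X₃ = ζ * X₁ := ⟨X₃ / X₁, (div_mul_cancel₀ X₃ h₁).symm⟩
    have h₂ : X₂ = -ζ ^ 2 * X₀ :=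
      mul_left_cancel₀ (pow_ne_zero 2 h₁) (by linear_combination h)
    subst h₂
    have hζ : X₀ ^ 2 * X₁ * (ζ * (ζ ^ 3 + 1)) = 0 := by linear_combination hj
    rcases mul_eq_zero.1 ((mul_eq_zero.1 hζ).resolve_left
      (mul_ne_zero (pow_ne_zero 2 h₀) h₁)) with rfl | hζ
    · simp
    · exact .inr <| .inr <| .inr <| .inr ⟨ζ, eq_neg_of_add_eq_zero_left hζ, rfl, rfl⟩
  · rintro (⟨rfl, rfl⟩ | ⟨rfl, rfl⟩ | ⟨rfl, rfl⟩ | ⟨rfl, rfl⟩ | ⟨ζ, hζ, rfl, rfl⟩)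
    · simp
    · simp
    · simp
    · simp
    · exact ⟨by ring, by linear_combination X₀ ^ 2 * X₁ * ζ * hζ⟩
end

section
/- The image of the slice-constant function ℓ₊, that is the set {(1 − I·i)/2 : I ∈ 𝕊} ⊆ ℍ, equals the set of quaternions q whose i-component vanishes and which satisfy Re(q) = |q|². (Equivalently, writing q = α + Jβ with J ∈ 𝕊 orthogonal to i, the image consists of the points with α = α² + β²: for each such J a circle of radius 1/2 through 0 and 1 centred at 1/2.) -/
/-- A real quaternion squares to `-1` iff it is purely imaginary of unit norm. -/
theorem Quaternion.mul_self_eq_neg_one_iff (I : Quaternion ℝ) :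
    I * I = -1 ↔ I.re = 0 ∧ I.imI ^ 2 + I.imJ ^ 2 + I.imK ^ 2 = 1 := by
  simp only [Quaternion.ext_iff, Quaternion.re_mul, Quaternion.imI_mul, Quaternion.imJ_mul,
    Quaternion.imK_mul, Quaternion.re_neg, Quaternion.imI_neg, Quaternion.imJ_neg,
    Quaternion.imK_neg, Quaternion.re_one, Quaternion.imI_one, Quaternion.imJ_one,
    Quaternion.imK_one]
  constructor
  · rintro ⟨h, hi, hj, hk⟩
    have hre : I.re = 0 := by
      by_contra hne
      have hI : I.imI = 0 := mul_left_cancel₀ hne (by linarith)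
      have hJ : I.imJ = 0 := mul_left_cancel₀ hne (by linarith)
      have hK : I.imK = 0 := mul_left_cancel₀ hne (by linarith)
      rw [hI, hJ, hK] at h
      nlinarith [mul_self_nonneg I.re]
    rw [hre] at h
    exact ⟨hre, by linarith⟩
  · rintro ⟨hre, h⟩
    rw [hre]
    exact ⟨by linarith, by ring, by ring, by ring⟩

/-- The equation `q = (1 - I * i) / 2` in components. -/
theorem eq_one_sub_mul_qi_div_two_iff (q I : Quaternion ℝ) :
    q = (1 - I * qi) / 2 ↔ q.re = (1 + I.imI) / 2 ∧ q.imI = -I.re / 2 ∧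
      q.imJ = -I.imK / 2 ∧ q.imK = I.imJ / 2 := by
  have hr : qi.re = 0 := rfl
  have hi : qi.imI = 1 := rfl
  have hj : qi.imJ = 0 := rfl
  have hk : qi.imK = 0 := rfl
  have two_eq : (2 : Quaternion ℝ) = ((2 : ℝ) : Quaternion ℝ) := rfl
  have half : (1 - I * qi) / 2 = (2 : ℝ)⁻¹ • (1 - I * qi) := by
    rw [two_eq, div_eq_mul_inv, ← Quaternion.coe_inv, Quaternion.mul_coe_eq_smul]
  rw [half]
  simp only [Quaternion.ext_iff, Quaternion.re_smul, Quaternion.imI_smul, Quaternion.imJ_smul,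
    Quaternion.imK_smul, Quaternion.re_sub, Quaternion.imI_sub, Quaternion.imJ_sub,
    Quaternion.imK_sub, Quaternion.re_mul, Quaternion.imI_mul, Quaternion.imJ_mul,
    Quaternion.imK_mul, Quaternion.re_one, Quaternion.imI_one, Quaternion.imJ_one,
    Quaternion.imK_one, hr, hi, hj, hk, smul_eq_mul]
  ring_nf

/-- The image of the slice-constant function `ℓ₊`, i.e. the set `{(1 − I·i)/2 : I ∈ 𝕊}`,
is the set of quaternions whose `i`-component vanishes and whose real part equals the
square of their norm. -/
theorem image_of_ell_plus :
    {q : Quaternion ℝ | ∃ I : Quaternion ℝ, I * I = -1 ∧ q = (1 - I * qi) / 2} =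
      {q : Quaternion ℝ | q.imI = 0 ∧ q.re = ‖q‖ ^ 2} := by
  ext q
  simp only [Set.mem_ofPred_eq, Quaternion.mul_self_eq_neg_one_iff,
    eq_one_sub_mul_qi_div_two_iff, pow_two ‖q‖, ← Quaternion.normSq_eq_norm_mul_self,
    Quaternion.normSq_def']
  constructor
  · rintro ⟨I, ⟨hre, h⟩, hr, hi, hj, hk⟩
    rw [hr, hi, hj, hk, hre]
    exact ⟨by norm_num, by linarith⟩
  · rintro ⟨hi, h⟩
    rw [hi] at h
    refine ⟨⟨0, 2 * q.re - 1, 2 * q.imK, -2 * q.imJ⟩, ⟨rfl, ?_⟩, ?_, ?_, ?_, ?_⟩ <;> dsimp only <;>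
      linarith
end
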